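/- Let K be a perfect field of characteristic p > 0, let S = K[x_1, …, x_n], let 𝔪 ⊆ S be a maximal ideal, and let q = p^e and q' = p^{e'} be powers of p. If u ∈ S satisfies u ∉ 𝔪^{[q]} and v ∈ S satisfies v ∉ 𝔪^{[q']}, then u · v^q ∉ 𝔪^{[q q']}. -/

import Mathlib

/-- The `q`-th Frobenius power `J^{[q]}` of an ideal: the ideal generated by
`q`-th powers of elements of `J`. -/
noncomputable def frobPow {R : Type*} [CommRing R] (J : Ideal R) (q : ℕ) : Ideal R :=
  Ideal.span ((fun a => a ^ q) '' (J : Set R))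

namespace MvPolynomial

variable {σ K : Type*} [Field K] (p : ℕ) [Fact p.Prime] [CharP K p] [PerfectRing K p] (e : ℕ)

/-- The coordinate of a polynomial at `x ^ a`, for `a : σ → Fin (p ^ e)`, with respect to the
monomial basis of `K[σ]` over its subring of `p ^ e`-th powers, followed by the extraction of
`p ^ e`-th roots. -/
noncomputable def frobCoord (a : σ → Fin (p ^ e)) : MvPolynomial σ K →+ MvPolynomial σ K :=
  open Classical in
  (Finsupp.liftAddHom fun d : σ →₀ ℕ =>
    if ∀ i, d i % p ^ e = a i then
      (monomial (d.mapRange (· / p ^ e) (Nat.zero_div _))).toAddMonoidHom.comp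
        (iterateFrobeniusEquiv K p e).symm.toAddMonoidHom
    else 0).comp AddMonoidAlgebra.coeffAddEquiv.toAddMonoidHom

open Classical in
theorem frobCoord_monomial (a : σ → Fin (p ^ e)) (d : σ →₀ ℕ) (c : K) :
    frobCoord p e a (monomial d c) =
      if ∀ i, d i % p ^ e = a i then
        monomial (d.mapRange (· / p ^ e) (Nat.zero_div _)) ((iterateFrobeniusEquiv K p e).symm c)
      else 0 := by
  refine (Finsupp.liftAddHom_apply_single _ d c).trans ?_
  split_ifs <;> rfl

theorem frobCoord_mul_pow (a : σ → Fin (p ^ e)) (f g : MvPolynomial σ K) :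
    frobCoord p e a (f * g ^ p ^ e) = frobCoord p e a f * g := by
  classical
  have hq : 0 < p ^ e := pow_pos (Fact.out : p.Prime).pos e
  induction f using induction_on' with
  | add f₁ f₂ h₁ h₂ => rw [add_mul, map_add, map_add, h₁, h₂, add_mul]
  | monomial d c =>
    induction g using induction_on' with
    | add g₁ g₂ h₁ h₂ => rw [add_pow_char_pow, mul_add, map_add, h₁, h₂, mul_add]
    | monomial b k =>
      have hk : (iterateFrobeniusEquiv K p e).symm (k ^ p ^ e) = k :=
        (iterateFrobeniusEquiv K p e).symm_apply_apply k
      have hd : (d + p ^ e • b).mapRange (· / p ^ e) (Nat.zero_div _) =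
          d.mapRange (· / p ^ e) (Nat.zero_div _) + b := by
        ext i
        simp [Nat.add_mul_div_left _ _ hq]
      rw [monomial_pow, monomial_mul, frobCoord_monomial, frobCoord_monomial, hd, map_mul, hk]
      simp [ite_mul]

theorem sum_monomial_mul_frobCoord_pow [Fintype σ] [DecidableEq σ] (f : MvPolynomial σ K) :
    ∑ a : σ → Fin (p ^ e), monomial (Finsupp.equivFunOnFinite.symm fun i => (a i : ℕ)) 1 *
      frobCoord p e a f ^ p ^ e = f := by
  have hq : 0 < p ^ e := pow_pos (Fact.out : p.Prime).pos e
  induction f using induction_on' with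
  | add f₁ f₂ h₁ h₂ =>
    simp only [map_add, add_pow_char_pow, mul_add, Finset.sum_add_distrib, h₁, h₂]
  | monomial d c =>
    rw [Finset.sum_eq_single fun i => (⟨d i % p ^ e, Nat.mod_lt _ hq⟩ : Fin (p ^ e))]
    · have hc : (iterateFrobeniusEquiv K p e).symm c ^ p ^ e = c :=
        (iterateFrobeniusEquiv K p e).apply_symm_apply c
      rw [frobCoord_monomial, if_pos fun _ => rfl, monomial_pow, monomial_mul, hc, one_mul]
      refine congrArg (fun d => monomial d c) (Finsupp.ext fun i => ?_)
      simp [Nat.mod_add_div]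
    · intro a _ ha
      rw [frobCoord_monomial, if_neg, zero_pow hq.ne', mul_zero]
      exact fun h => ha (_root_.funext fun i => Fin.ext (h i).symm)
    · simp

end MvPolynomial

theorem pow_mem_frobPow {R : Type*} [CommRing R] {J : Ideal R} {a : R} (ha : a ∈ J) (q : ℕ) :
    a ^ q ∈ frobPow J q :=
  Ideal.subset_span ⟨a, ha, rfl⟩

theorem frobPow_mul_le {R : Type*} [CommRing R] (J : Ideal R) (q q' : ℕ) :
    frobPow J (q * q') ≤ frobPow (frobPow J q') q := by
  refine Ideal.span_le.2 ?_
  rintro _ ⟨a, ha, rfl⟩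
  simpa only [mul_comm q, pow_mul] using! pow_mem_frobPow (pow_mem_frobPow ha q') q

theorem Ideal.IsMaximal.mem_of_mul_mem_frobPow {R : Type*} [CommRing R] {m : Ideal R}
    (hm : m.IsMaximal) {q : ℕ} {w v : R} (hv : v ∉ frobPow m q) (h : w * v ∈ frobPow m q) :
    w ∈ m := by
  by_contra hw
  obtain ⟨y, i, hi, hy⟩ := hm.exists_inv hw
  obtain ⟨z, hz⟩ : y * w ∣ 1 - i ^ q := by
    rw [eq_sub_of_add_eq hy]
    simpa using sub_dvd_pow_sub_pow 1 i q
  refine hv ?_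
  have : v = z * y * (w * v) + v * i ^ q := by linear_combination v * hz
  rw [this]
  exact add_mem (Ideal.mul_mem_left _ _ h) (Ideal.mul_mem_left _ _ (pow_mem_frobPow hi q))

theorem MvPolynomial.frobCoord_mem {σ K : Type*} [Field K] (p : ℕ) [Fact p.Prime] [CharP K p]
    [PerfectRing K p] (e : ℕ) {J : Ideal (MvPolynomial σ K)} {f : MvPolynomial σ K}
    (hf : f ∈ frobPow J (p ^ e)) (a : σ → Fin (p ^ e)) : frobCoord p e a f ∈ J := by
  suffices h : ∀ r, frobCoord p e a (r * f) ∈ J by simpa only [one_mul] using h 1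
  refine Submodule.span_induction (p := fun x _ => ∀ r, frobCoord p e a (r * x) ∈ J)
    ?_ ?_ ?_ ?_ hf
  · rintro _ ⟨b, hb, rfl⟩ r
    rw [frobCoord_mul_pow]
    exact J.mul_mem_left _ hb
  · simp
  · intro x y _ _ hx hy r
    rw [mul_add, map_add]
    exact add_mem (hx r) (hy r)
  · intro s x _ hx r
    rw [smul_eq_mul, ← mul_assoc]
    exact hx (r * s)

/-- multiplicativity of non-membership in Frobenius powers of a maximal
ideal of a polynomial ring over a perfect field of characteristic `p > 0`. If
`u ∉ 𝔪^{[q]}` and `v ∉ 𝔪^{[q']}` with `q = p^e`, `q' = p^{e'}`, then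
`u · v^q ∉ 𝔪^{[q q']}`. -/
theorem stmt_8 (p : ℕ) [Fact p.Prime] (K : Type*) [Field K] [CharP K p] [PerfectRing K p]
    (n : ℕ) (𝔪 : Ideal (MvPolynomial (Fin n) K)) (hm : 𝔪.IsMaximal)
    (e e' : ℕ) (u v : MvPolynomial (Fin n) K)
    (hu : u ∉ frobPow 𝔪 (p ^ e)) (hv : v ∉ frobPow 𝔪 (p ^ e')) :
    u * v ^ p ^ e ∉ frobPow 𝔪 (p ^ e * p ^ e') := by
  intro h
  refine hu ?_
  rw [← MvPolynomial.sum_monomial_mul_frobCoord_pow p e u]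
  refine sum_mem fun a _ => Ideal.mul_mem_left _ _ (pow_mem_frobPow ?_ _)
  refine hm.mem_of_mul_mem_frobPow hv ?_
  rw [← MvPolynomial.frobCoord_mul_pow]
  exact MvPolynomial.frobCoord_mem p e (frobPow_mul_le 𝔪 _ _ h) a
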